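/- Let K be an algebraically closed field of characteristic 2 and let X ⊂ ℙ³ be the quartic surface defined by x₀⁴ + x₁x₂³ + x₁³x₃ + x₀x₂x₃² = 0, and let ℓ be the line x₀ = x₁ = 0 (which lies on X). For every t ∈ K with t¹⁹ = 1, the line L_t cut out by the two linear forms x₀ + t·x₁ and x₁ + t⁵·x₂ + t¹⁵·x₃ lies on X and has nonempty intersection with ℓ. The 19 lines L_t are pairwise distinct and distinct from ℓ, and every line lying on X that is distinct from ℓ and meets ℓ equals L_t for some t with t¹⁹ = 1. -/

import Mathlib

open MvPolynomial

/-- The quartic `x₀⁴ + x₁x₂³ + x₁³x₃ + x₀x₂x₃²`. -/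
noncomputable def exQuartic (K : Type*) [Field K] : MvPolynomial (Fin 4) K :=
  X 0 ^ 4 + X 1 * X 2 ^ 3 + X 1 ^ 3 * X 3 + X 0 * X 2 * X 3 ^ 2

/-- The line `L_t` cut out by the two linear forms `x₀ + t·x₁` and
`x₁ + t⁵·x₂ + t¹⁵·x₃`, as an intersection of kernels. -/
noncomputable def cutLine (K : Type*) [Field K] (t : K) : Submodule K (Fin 4 → K) :=
  LinearMap.ker ((LinearMap.proj 0 : (Fin 4 → K) →ₗ[K] K)
      + t • (LinearMap.proj 1 : (Fin 4 → K) →ₗ[K] K)) ⊓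
  LinearMap.ker ((LinearMap.proj 1 : (Fin 4 → K) →ₗ[K] K)
      + t ^ 5 • (LinearMap.proj 2 : (Fin 4 → K) →ₗ[K] K)
      + t ^ 15 • (LinearMap.proj 3 : (Fin 4 → K) →ₗ[K] K))

/-- The line `ℓ : x₀ = x₁ = 0`. -/
noncomputable def ell (K : Type*) [Field K] : Submodule K (Fin 4 → K) :=
  Submodule.span K {![0, 0, 1, 0], ![0, 0, 0, 1]}

theorem eval_exQuartic {K : Type*} [Field K] (v : Fin 4 → K) :
    eval v (exQuartic K) =
      v 0 ^ 4 + v 1 * v 2 ^ 3 + v 1 ^ 3 * v 3 + v 0 * v 2 * v 3 ^ 2 := by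
  simp [exQuartic]

theorem mem_ell {K : Type*} [Field K] {v : Fin 4 → K} :
    v ∈ ell K ↔ v 0 = 0 ∧ v 1 = 0 := by
  rw [ell, Submodule.mem_span_pair]
  constructor
  · rintro ⟨a, b, rfl⟩
    simp
  · rintro ⟨h0, h1⟩
    refine ⟨v 2, v 3, ?_⟩
    ext i
    fin_cases i <;> simp [h0, h1]

theorem mem_cutLine {K : Type*} [Field K] {t : K} {v : Fin 4 → K} :
    v ∈ cutLine K t ↔ v 0 + t * v 1 = 0 ∧ v 1 + t ^ 5 * v 2 + t ^ 15 * v 3 = 0 := by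
  simp [cutLine]

theorem finrank_span_pair_of_linearIndependent {K V : Type*} [Field K] [AddCommGroup V]
    [Module K V] {x y : V} (h : LinearIndependent K ![x, y]) :
    Module.finrank K (Submodule.span K {x, y}) = 2 := by
  have := finrank_span_eq_card h
  rwa [Matrix.range_cons_cons_empty, Fintype.card_fin] at this

theorem finrank_ell (K : Type*) [Field K] : Module.finrank K (ell K) = 2 := by
  refine finrank_span_pair_of_linearIndependent (LinearIndependent.pair_iff.2 fun a b h ↦ ?_)
  exact ⟨by simpa using congrFun h 2, by simpa using congrFun h 3⟩

theorem cutLine_eq_span {K : Type*} [Field K] [CharP K 2] {t : K} (ht : t ^ 19 = 1) :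
    cutLine K t = Submodule.span K {![t, 1, t ^ 14, 0], ![0, 0, t ^ 10, 1]} := by
  have h2 : (2 : K) = 0 := CharTwo.two_eq_zero
  ext v
  rw [mem_cutLine, Submodule.mem_span_pair]
  constructor
  · rintro ⟨h, h'⟩
    refine ⟨v 1, v 3, ?_⟩
    ext i
    fin_cases i
    · simp
      linear_combination -h + t * v 1 * h2
    · simp
    · simp
      linear_combination (v 2 - t ^ 10 * v 3) * ht - t ^ 14 * h' +
        (t ^ 14 * v 1 + t ^ 10 * v 3 * t ^ 19) * h2
    · simp
  · rintro ⟨a, b, rfl⟩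
    simp
    constructor
    · linear_combination a * t * h2
    · linear_combination a * ht + (a + t ^ 15 * b) * h2

theorem finrank_cutLine {K : Type*} [Field K] [CharP K 2] {t : K} (ht : t ^ 19 = 1) :
    Module.finrank K (cutLine K t) = 2 := by
  rw [cutLine_eq_span ht]
  refine finrank_span_pair_of_linearIndependent (LinearIndependent.pair_iff.2 fun a b h ↦ ?_)
  exact ⟨by simpa using congrFun h 1, by simpa using congrFun h 3⟩

theorem eval_exQuartic_of_mem_cutLine {K : Type*} [Field K] [CharP K 2] {t : K}
    (ht : t ^ 19 = 1) {v : Fin 4 → K} (hv : v ∈ cutLine K t) :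
    eval v (exQuartic K) = 0 := by
  have h2 : (2 : K) = 0 := CharTwo.two_eq_zero
  obtain ⟨h, h'⟩ := mem_cutLine.1 hv
  have e0 : v 0 = t * v 1 := by linear_combination h - t * v 1 * h2
  have e1 : v 1 = t ^ 5 * v 2 + t ^ 15 * v 3 := by
    linear_combination h' - (t ^ 5 * v 2 + t ^ 15 * v 3) * h2
  have key : t ^ 4 * v 1 ^ 3 + v 2 ^ 3 + v 1 ^ 2 * v 3 + t * v 2 * v 3 ^ 2 = 0 := by
    rw [e1]
    linear_combination (v 2 ^ 3 + 3 * t ^ 10 * v 2 ^ 2 * v 3 + 3 * t ^ 20 * v 2 * v 3 ^ 2 +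
      5 * t * v 2 * v 3 ^ 2 + t ^ 30 * v 3 ^ 3) * ht +
      (v 2 ^ 3 + 2 * t ^ 10 * v 2 ^ 2 * v 3 + 3 * t * v 2 * v 3 ^ 2 +
        t ^ 30 * v 3 ^ 3) * h2
  rw [eval_exQuartic, e0]
  linear_combination v 1 * key

theorem cubic_coeffs_eq_zero {K : Type*} [Field K] [Infinite K] {a b c d : K}
    (h : ∀ s : K, a * s ^ 3 + b * s ^ 2 + c * s + d = 0) :
    a = 0 ∧ b = 0 ∧ c = 0 ∧ d = 0 := by
  have h0 : (⟨a, b, c, d⟩ : Cubic K).toPoly = 0 :=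
    Polynomial.funext fun s ↦ by simpa [Cubic.toPoly] using h s
  exact Cubic.ext_iff.1 ((Cubic.toPoly_eq_zero_iff _).1 h0)

/-- If the quartic vanishes along `q + s • p` with `p ∈ ℓ` nonzero and `q ∉ ℓ`, then `q 1 ≠ 0`. -/
theorem apply_one_ne_zero {K : Type*} [Field K] [Infinite K] {p q : Fin 4 → K}
    (hp : p ∈ ell K) (hp0 : p ≠ 0) (hq : q ∉ ell K)
    (h : ∀ s : K, eval (q + s • p) (exQuartic K) = 0) : q 1 ≠ 0 := by
  intro hq1
  obtain ⟨p0, p1⟩ := mem_ell.1 hp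
  have q0 : q 0 ≠ 0 := fun hq0 ↦ hq (mem_ell.2 ⟨hq0, hq1⟩)
  have hp23 : p 2 ≠ 0 ∨ p 3 ≠ 0 := by
    by_contra! hc
    exact hp0 (by ext i; fin_cases i <;> simp [*])
  simp only [eval_exQuartic, Pi.add_apply, Pi.smul_apply, smul_eq_mul, p0, p1, hq1] at h
  obtain ⟨h3, h2, h1, h0⟩ := cubic_coeffs_eq_zero
    (a := q 0 * p 2 * p 3 ^ 2) (b := q 0 * (q 2 * p 3 ^ 2 + 2 * p 2 * p 3 * q 3))
    (c := q 0 * (p 2 * q 3 ^ 2 + 2 * q 2 * p 3 * q 3)) (d := q 0 ^ 4 + q 0 * q 2 * q 3 ^ 2)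
    fun s ↦ by linear_combination h s
  grind

/-- If the line through `(0 : 0 : c : d)` and `(t : 1 : a : b)` lies on the quartic, then
`t ^ 19 = 1` and both points satisfy the equations of `L_t`. -/
theorem root_of_unity_of_eval_eq_zero {K : Type*} [Field K] [Infinite K] [CharP K 2]
    {t a b c d : K} (hcd : c ≠ 0 ∨ d ≠ 0)
    (h : ∀ s : K, t ^ 4 + (a + s * c) ^ 3 + (b + s * d) + t * (a + s * c) * (b + s * d) ^ 2 = 0) :
    t ^ 19 = 1 ∧ c = t ^ 10 * d ∧ d ≠ 0 ∧ a - t ^ 10 * b = t ^ 14 := by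
  have h2 : (2 : K) = 0 := CharTwo.two_eq_zero
  obtain ⟨e3, e2, e1, e0⟩ := cubic_coeffs_eq_zero
    (a := c ^ 3 + t * c * d ^ 2) (b := c ^ 2 * a + t * d ^ 2 * a)
    (c := c * a ^ 2 + d + t * c * b ^ 2) (d := t ^ 4 + a ^ 3 + b + t * a * b ^ 2)
    fun s ↦ by
      linear_combination h s - (a * c ^ 2 * s ^ 2 + a ^ 2 * c * s + t * c * b * d * s ^ 2 +
        t * a * b * d * s) * h2
  have hc : c ≠ 0 := by rintro rfl; grind
  have hd : d ≠ 0 := by rintro rfl; grind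
  obtain ⟨u, rfl⟩ : ∃ u, c = u * d := ⟨c / d, by field_simp⟩
  have hu : u ≠ 0 := left_ne_zero_of_mul hc
  have htu : t = u ^ 2 := by
    have : u * d ^ 3 * (u ^ 2 + t) = 0 := by linear_combination e3
    have := (mul_eq_zero.1 this).resolve_left (mul_ne_zero hu (pow_ne_zero 3 hd))
    linear_combination this - u ^ 2 * h2
  subst htu
  have hua : u * a ^ 2 + u ^ 3 * b ^ 2 + 1 = 0 :=
    mul_left_cancel₀ hd (by linear_combination e1)
  obtain ⟨w, rfl⟩ : ∃ w, a = w + u * b := ⟨a - u * b, by ring⟩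
  have hw2 : u * w ^ 2 = 1 := by
    linear_combination hua - (u ^ 2 * w * b + u ^ 3 * b ^ 2 + 1) * h2
  have hw3 : w ^ 3 = u ^ 8 := by
    linear_combination e0 - b * hw2 -
      (u ^ 8 + u * w ^ 2 * b + 2 * u ^ 2 * w * b ^ 2 + u ^ 3 * b ^ 3 + b) * h2
  have hu19 : u ^ 19 = 1 := by
    linear_combination (u ^ 2 * w ^ 4 + u * w ^ 2 + 1) * hw2 - u ^ 3 * (w ^ 3 + u ^ 8) * hw3
  have hw : w = u ^ 9 := by linear_combination u * hw3 - w * hw2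
  refine ⟨?_, ?_, hd, ?_⟩
  · linear_combination (u ^ 19 + 1) * hu19
  · linear_combination -u * d * hu19
  · linear_combination hw - (u * b + u ^ 9) * hu19

/-- Over an algebraically closed field of characteristic 2, for the
quartic `x₀⁴ + x₁x₂³ + x₁³x₃ + x₀x₂x₃² = 0` and the line `ℓ : x₀ = x₁ = 0` (which lies
on it): for every `t` with `t¹⁹ = 1` the line `L_t` cut out by `x₀ + t·x₁` and
`x₁ + t⁵x₂ + t¹⁵x₃` lies on the quartic and meets `ℓ`; the lines `L_t` are pairwise
distinct and distinct from `ℓ`; and every line on the quartic distinct from `ℓ` and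
meeting `ℓ` is `L_t` for some `t` with `t¹⁹ = 1`. -/
theorem exQuartic_lines_meeting_ell (K : Type*) [Field K] [IsAlgClosed K] [CharP K 2] :
    (∀ v ∈ ell K, eval v (exQuartic K) = 0) ∧
    (∀ t : K, t ^ 19 = 1 →
      Module.finrank K (cutLine K t) = 2 ∧
      (∀ v ∈ cutLine K t, eval v (exQuartic K) = 0) ∧
      cutLine K t ⊓ ell K ≠ ⊥ ∧ cutLine K t ≠ ell K) ∧
    (∀ t t' : K, t ^ 19 = 1 → t' ^ 19 = 1 → cutLine K t = cutLine K t' → t = t') ∧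
    (∀ W : Submodule K (Fin 4 → K),
      Module.finrank K W = 2 → (∀ v ∈ W, eval v (exQuartic K) = 0) →
      W ≠ ell K → W ⊓ ell K ≠ ⊥ →
      ∃ t : K, t ^ 19 = 1 ∧ W = cutLine K t) := by
  refine ⟨fun v hv ↦ ?_, fun t ht ↦ ⟨finrank_cutLine ht,
    fun v hv ↦ eval_exQuartic_of_mem_cutLine ht hv, fun h ↦ ?_, fun h ↦ ?_⟩,
    fun t t' ht _ h ↦ ?_, fun W hW hF hne hmeet ↦ ?_⟩
  · obtain ⟨h0, h1⟩ := mem_ell.1 hv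
    simp [eval_exQuartic, h0, h1]
  · have hp : ![0, 0, t ^ 10, 1] ∈ cutLine K t ⊓ ell K := by
      refine ⟨?_, mem_ell.2 (by simp)⟩
      rw [cutLine_eq_span ht]
      exact Submodule.subset_span (by simp)
    rw [h, Submodule.mem_bot] at hp
    simpa using congrFun hp 3
  · have hq : ![t, 1, t ^ 14, 0] ∈ cutLine K t := by
      rw [cutLine_eq_span ht]
      exact Submodule.subset_span (by simp)
    rw [h, mem_ell] at hq
    simp at hq
  · have hq : ![t, 1, t ^ 14, 0] ∈ cutLine K t := by
      rw [cutLine_eq_span ht]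
      exact Submodule.subset_span (by simp)
    rw [h, mem_cutLine] at hq
    exact CharTwo.add_eq_zero.1 (by simpa using hq.1)
  · obtain ⟨p, ⟨hpW, hp⟩, hp0⟩ := Submodule.exists_mem_ne_zero_of_ne_bot hmeet
    obtain ⟨q, hqW, hq⟩ : ∃ q ∈ W, q ∉ ell K := by
      by_contra! hle
      exact hne (Submodule.eq_of_le_of_finrank_eq hle (hW.trans (finrank_ell K).symm))
    have hmem : ∀ r s : K, r • q + s • p ∈ W := fun r s ↦
      W.add_mem (W.smul_mem r hqW) (W.smul_mem s hpW)
    have hq1 : q 1 ≠ 0 := apply_one_ne_zero hp hp0 hq fun s ↦ hF _ (by simpa using hmem 1 s)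
    obtain ⟨hp0', hp1⟩ := mem_ell.1 hp
    have hp23 : p 2 ≠ 0 ∨ p 3 ≠ 0 := by
      by_contra! hc
      exact hp0 (by ext i; fin_cases i <;> simp [*])
    obtain ⟨ht, hc, hd, ha⟩ := root_of_unity_of_eval_eq_zero (t := q 0 / q 1) (a := q 2 / q 1)
      (b := q 3 / q 1) hp23 fun s ↦ by
        have := hF _ (hmem (q 1)⁻¹ s)
        simpa [eval_exQuartic, hp0', hp1, hq1, div_eq_inv_mul] using this
    refine ⟨q 0 / q 1, ht, (Submodule.eq_of_le_of_finrank_eq ?_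
      ((finrank_cutLine ht).trans hW.symm)).symm⟩
    have hp' : ![0, 0, (q 0 / q 1) ^ 10, 1] ∈ W := by
      convert W.smul_mem (p 3)⁻¹ hpW using 1
      ext i
      fin_cases i <;> simp [hp0', hp1, hd, hc]
      field_simp
    rw [cutLine_eq_span ht, Submodule.span_le, Set.pair_subset_iff]
    refine ⟨?_, hp'⟩
    have hq' := W.sub_mem (W.smul_mem (q 1)⁻¹ hqW) (W.smul_mem (q 3 / q 1) hp')
    rw [SetLike.mem_coe]
    convert hq' using 1
    ext i
    fin_cases i
    · simp [div_eq_inv_mul]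
    · simp [hq1]
    · simp
      linear_combination -ha
    · simp [div_eq_inv_mul]
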